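/- There are no T > 3 and no Lipschitz continuous function w : ℝ → ℝ with w(0) = −1 such that for almost every t ∈ (0,T) there exists d ∈ ℝ with: w differentiable at t with derivative d, W₀ differentiable at w(t), and t − W₀'(w(t)) ∈ ∂R₁(d), i.e. |y| ≥ |d| + (t − W₀'(w(t)))·(y − d) for all y ∈ ℝ. In other words, the strong solution of the scalar rate-independent system ∂R₁(u̇) ∋ f − W₀'(u) starting at u(0) = −1 cannot be continued beyond time t = 3 as a (continuous) strong solution; past t = 3 the evolution can only be continued as a weak solution with a jump. -/

import Mathlib

open MeasureTheory

/-- The double-well potential of the scalar example: `W₀(z) = min{z(z+2), z(z−2)}`. -/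
noncomputable def W0 (z : ℝ) : ℝ := min (z * (z + 2)) (z * (z - 2))

/-- The double-well potential in terms of the absolute value. -/
theorem W0_eq_sq_sub_abs (z : ℝ) : W0 z = z ^ 2 - 2 * |z| := by
  unfold W0
  rcases le_total 0 z with h | h
  · rw [abs_of_nonneg h, min_eq_right (by nlinarith)]
    ring
  · rw [abs_of_nonpos h, min_eq_left (by nlinarith)]
    ring

theorem not_differentiableAt_W0_zero : ¬ DifferentiableAt ℝ W0 0 := by
  intro h
  apply not_differentiableAt_abs_zero
  have habs : (abs : ℝ → ℝ) = fun z => (z ^ 2 - W0 z) / 2 := by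
    funext z
    rw [W0_eq_sq_sub_abs]
    ring
  rw [habs]
  fun_prop

theorem deriv_W0_of_neg {z : ℝ} (hz : z < 0) : deriv W0 z = 2 * z + 2 := by
  have heq : W0 =ᶠ[nhds z] fun x => x ^ 2 + 2 * x := by
    filter_upwards [Iio_mem_nhds hz] with x hx
    rw [W0_eq_sq_sub_abs, abs_of_neg hx]
    ring
  rw [heq.deriv_eq]
  have h := (hasDerivAt_pow 2 z).fun_add ((hasDerivAt_id' z).const_mul 2)
  simpa using h.deriv

theorem deriv_W0_of_pos {z : ℝ} (hz : 0 < z) : deriv W0 z = 2 * z - 2 := by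
  have heq : W0 =ᶠ[nhds z] fun x => x ^ 2 - 2 * x := by
    filter_upwards [Ioi_mem_nhds hz] with x hx
    rw [W0_eq_sq_sub_abs, abs_of_pos hx]
  rw [heq.deriv_eq]
  have h := (hasDerivAt_pow 2 z).fun_sub ((hasDerivAt_id' z).const_mul 2)
  simpa using h.deriv

/-- Subgradients of the absolute value lie in `[-1, 1]`. -/
theorem abs_le_one_of_abs_subgradient {ξ d : ℝ} (h : ∀ y : ℝ, |y| ≥ |d| + ξ * (y - d)) :
    |ξ| ≤ 1 := by
  rw [abs_le]
  constructor
  · linarith [h (d - 1), abs_sub d 1, abs_one (α := ℝ)]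
  · linarith [h (d + 1), abs_add_le d 1, abs_one (α := ℝ)]

/-- The strong solution of the scalar rate-independent system
`∂R₁(u̇) ∋ f − W₀'(u)` (with `f(t) = t`, `R₁ = |·|`) starting at `u(0) = −1` cannot be
continued beyond time `t = 3` as a Lipschitz (strong) solution. -/
theorem no_strong_solution_beyond_three :
    ¬ ∃ T : ℝ, 3 < T ∧ ∃ w : ℝ → ℝ,
      (∃ K : NNReal, LipschitzWith K w) ∧ w 0 = -1 ∧
      ∀ᵐ t ∂(volume.restrict (Set.Ioo (0:ℝ) T)),
        ∃ d : ℝ, HasDerivAt w d t ∧ DifferentiableAt ℝ W0 (w t) ∧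
          ∀ y : ℝ, |y| ≥ |d| + (t - deriv W0 (w t)) * (y - d) := by
  rintro ⟨T, hT, w, ⟨K, hK⟩, hw0, hae⟩
  have hcont : Continuous w := hK.continuous
  have hstable : ∀ᵐ t : ℝ, t ∈ Set.Ioo (0 : ℝ) T →
      (w t < 0 ∧ t - 3 ≤ 2 * w t) ∨ (0 < w t ∧ t + 1 ≤ 2 * w t) := by
    rw [ae_restrict_iff' measurableSet_Ioo] at hae
    filter_upwards [hae] with t ht hmem
    obtain ⟨d, -, hdiff, hsub⟩ := ht hmem
    have hle := (abs_le.mp (abs_le_one_of_abs_subgradient hsub)).2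
    rcases lt_trichotomy (w t) 0 with h | h | h
    · rw [deriv_W0_of_neg h] at hle
      exact Or.inl ⟨h, by linarith⟩
    · exact absurd (h ▸ hdiff) not_differentiableAt_W0_zero
    · rw [deriv_W0_of_pos h] at hle
      exact Or.inr ⟨h, by linarith⟩
  have hdense := Measure.dense_of_ae hstable
  obtain ⟨t, ht, ht3, htT⟩ :=
    hdense.inter_open_nonempty (Set.Ioo 3 T) isOpen_Ioo (Set.nonempty_Ioo.mpr hT) |>.imp
      fun t h => And.intro h.2 h.1
  have hwt : t + 1 ≤ 2 * w t := by
    rcases ht ⟨by linarith, htT⟩ with h | h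
    · linarith [h.1, h.2]
    · exact h.2
  obtain ⟨s, ⟨hs0, hst⟩, hws⟩ : (1 / 4 : ℝ) ∈ w '' Set.Icc 0 t :=
    intermediate_value_Icc (by linarith) hcont.continuousOn
      ⟨by rw [hw0]; norm_num, by linarith⟩
  have hs_pos : 0 < s := lt_of_le_of_ne hs0 fun h => by
    rw [← h, hw0] at hws
    norm_num at hws
  obtain ⟨r, ⟨hrmem, hrw⟩, hr⟩ :=
    hdense.inter_open_nonempty (Set.Ioo 0 T ∩ w ⁻¹' Set.Ioo 0 (1 / 2))
      (isOpen_Ioo.inter (isOpen_Ioo.preimage hcont))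
      ⟨s, ⟨hs_pos, by linarith⟩, by rw [Set.mem_preimage, hws]; norm_num⟩
  rcases hr hrmem with h | h
  · linarith [h.1, hrw.1]
  · linarith [h.2, hrw.2, hrmem.1]
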